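/- arXiv:0806.4204 — 3 statements merged into one kernel-verified Lean document; each statement's English description precedes it below -/
import Mathlib

section
/- Let Ψ be an Orlicz function satisfying the Δ⁰ condition and (Ω,P) a probability space. Then for every 1 ≤ p < ∞ the Orlicz space L^Ψ embeds continuously into L^p: there exists a constant C > 0 such that ‖f‖_{L^p} ≤ C ‖f‖_Ψ for all f ∈ L^Ψ. -/
open MeasureTheory Filter Set Topology ENNReal NNReal

noncomputable section

/-- An Orlicz function: non-decreasing, convex (indeed strictly convex), vanishing and
continuous at `0`, with `Ψ x / x → ∞` as `x → ∞`. (We regard it as a function `ℝ → ℝ`,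
only its values on `[0,∞)` being relevant.) -/
structure IsOrliczFunction (Ψ : ℝ → ℝ) : Prop where
  map_zero : Ψ 0 = 0
  nonneg : ∀ x, 0 ≤ Ψ x
  mono : MonotoneOn Ψ (Set.Ici (0 : ℝ))
  strictConvexOn : StrictConvexOn ℝ (Set.Ici (0 : ℝ)) Ψ
  continuousWithinAt_zero : ContinuousWithinAt Ψ (Set.Ici (0 : ℝ)) 0
  tendsto_div_atTop : Tendsto (fun x => Ψ x / x) atTop atTop

/-- The Orlicz modular `∫ Ψ(|f|/C) dμ` (as an extended nonneg real). -/
def orliczModular {Ω : Type*} [MeasurableSpace Ω] (Ψ : ℝ → ℝ) (μ : Measure Ω)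
    (f : Ω → ℂ) (C : ℝ) : ℝ≥0∞ :=
  ∫⁻ ω, ENNReal.ofReal (Ψ (‖f ω‖ / C)) ∂μ

/-- The Luxemburg norm. -/
def luxNorm {Ω : Type*} [MeasurableSpace Ω] (Ψ : ℝ → ℝ) (μ : Measure Ω) (f : Ω → ℂ) : ℝ :=
  sInf {C : ℝ | 0 < C ∧ orliczModular Ψ μ f C ≤ 1}

/-- Membership in the Orlicz space `L^Ψ`. -/
def MemOrlicz {Ω : Type*} [MeasurableSpace Ω] (Ψ : ℝ → ℝ) (μ : Measure Ω) (f : Ω → ℂ) : Prop :=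
  AEStronglyMeasurable f μ ∧ ∃ C > 0, orliczModular Ψ μ f C < ⊤

/-- Membership in the Morse–Transue space `M^Ψ` (the closure of `L^∞` in `L^Ψ`). -/
def MemMorseTransue {Ω : Type*} [MeasurableSpace Ω] (Ψ : ℝ → ℝ) (μ : Measure Ω)
    (f : Ω → ℂ) : Prop :=
  AEStronglyMeasurable f μ ∧ ∀ C > 0, orliczModular Ψ μ f C < ⊤

/-- A subspace `X` is closed (in the Luxemburg norm) in the Morse–Transue space. -/
def IsLuxClosedIn {Ω : Type*} [MeasurableSpace Ω] (Ψ : ℝ → ℝ) (μ : Measure Ω)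
    (X : Submodule ℂ (Ω → ℂ)) : Prop :=
  ∀ f : Ω → ℂ, MemMorseTransue Ψ μ f →
    (∀ ε > 0, ∃ g ∈ X, luxNorm Ψ μ (f - g) < ε) → f ∈ X

/-- A set in a normed space is relatively weakly compact. -/
def RelWeaklyCompact {Y : Type*} [NormedAddCommGroup Y] [NormedSpace ℂ Y] (S : Set Y) : Prop :=
  ∃ K : Set (WeakSpace ℂ Y), IsCompact K ∧ (toWeakSpace ℂ Y) '' S ⊆ K

/-- The unit ball of a subspace `X` of `L^Ψ` for the Luxemburg norm. -/
def luxUnitBall {Ω : Type*} [MeasurableSpace Ω] (Ψ : ℝ → ℝ) (μ : Measure Ω)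
    (X : Submodule ℂ (Ω → ℂ)) : Set X :=
  {f : X | luxNorm Ψ μ (f : Ω → ℂ) ≤ 1}

/-- An operator on a subspace of `L^Ψ` is weakly compact if the image of the unit ball is
relatively weakly compact. -/
def IsWeaklyCompactOp {Ω : Type*} [MeasurableSpace Ω] (Ψ : ℝ → ℝ) (μ : Measure Ω)
    {X : Submodule ℂ (Ω → ℂ)} {Y : Type*} [NormedAddCommGroup Y] [NormedSpace ℂ Y]
    (T : X →ₗ[ℂ] Y) : Prop :=
  RelWeaklyCompact (⇑T '' luxUnitBall Ψ μ X)

/-- An operator on a subspace of `L^Ψ` is compact if the image of the unit ball is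
relatively norm compact. -/
def IsCompactOp {Ω : Type*} [MeasurableSpace Ω] (Ψ : ℝ → ℝ) (μ : Measure Ω)
    {X : Submodule ℂ (Ω → ℂ)} {Y : Type*} [NormedAddCommGroup Y] [NormedSpace ℂ Y]
    (T : X →ₗ[ℂ] Y) : Prop :=
  IsCompact (closure (⇑T '' luxUnitBall Ψ μ X))

/-- `T` fixes a copy of `c₀`: there is a sequence in `X`, equivalent to the canonical basis
of `c₀`, on whose (closed) span `T` is an isomorphism onto its image. -/
def FixesCopyOfC0 {Ω : Type*} [MeasurableSpace Ω] (Ψ : ℝ → ℝ) (μ : Measure Ω)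
    {X : Submodule ℂ (Ω → ℂ)} {Y : Type*} [NormedAddCommGroup Y] [NormedSpace ℂ Y]
    (T : X →ₗ[ℂ] Y) : Prop :=
  ∃ (u : ℕ → X) (a b c : ℝ), 0 < a ∧ 0 < b ∧ 0 < c ∧
    ∀ (co : ℕ → ℂ) (s : Finset ℕ),
      a * (⨆ k ∈ s, ‖co k‖) ≤ luxNorm Ψ μ ((∑ k ∈ s, co k • u k : X) : Ω → ℂ) ∧
      luxNorm Ψ μ ((∑ k ∈ s, co k • u k : X) : Ω → ℂ) ≤ b * (⨆ k ∈ s, ‖co k‖) ∧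
      c * (⨆ k ∈ s, ‖co k‖) ≤ ‖T (∑ k ∈ s, co k • u k)‖

/-- The complementary (conjugate) Orlicz function `Φ(x) = sup_{y ≥ 0} (xy - Ψ(y))`. -/
def complementaryOrlicz (Ψ : ℝ → ℝ) (x : ℝ) : ℝ :=
  sSup ((fun y => x * y - Ψ y) '' Set.Ici (0 : ℝ))

/-- The `Δ₂` condition. -/
def Delta2 (Φ : ℝ → ℝ) : Prop :=
  ∃ K > 0, ∃ x₀ > 0, ∀ x ≥ x₀, Φ (2 * x) ≤ K * Φ x

/-- The `Δ⁰` condition: for some `β > 1`, `Ψ(βx)/Ψ(x) → ∞` as `x → ∞`. -/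
def Delta0 (Ψ : ℝ → ℝ) : Prop :=
  ∃ β > 1, Tendsto (fun x => Ψ (β * x) / Ψ x) atTop atTop

end

noncomputable section

/-- A nonnegative function, monotone on `[0,∞)`, which grows by a factor `β ^ p` under dilation
by `β` dominates a multiple of `x ^ p` far away. -/
theorem rpow_le_mul_of_dilation_growth {Ψ : ℝ → ℝ} (hmono : MonotoneOn Ψ (Set.Ici (0 : ℝ)))
    {β p x₀ : ℝ} (hβ : 1 < β) (hp : 0 ≤ p) (hx₀ : 0 < x₀) (hpos : 0 < Ψ x₀)
    (hgrow : ∀ x, x₀ ≤ x → β ^ p * Ψ x ≤ Ψ (β * x)) {x : ℝ} (hx : x₀ ≤ x) :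
    x ^ p ≤ (β * x₀) ^ p / Ψ x₀ * Ψ x := by
  have hβ0 : 0 < β := one_pos.trans hβ
  have hiter : ∀ n : ℕ, (β ^ n) ^ p * Ψ x₀ ≤ Ψ (β ^ n * x₀) := by
    intro n
    induction n with
    | zero => simp
    | succ n ih =>
      have h1 : x₀ ≤ β ^ n * x₀ := le_mul_of_one_le_left hx₀.le (one_le_pow₀ hβ.le)
      calc (β ^ (n + 1)) ^ p * Ψ x₀ = β ^ p * ((β ^ n) ^ p * Ψ x₀) := by
            rw [pow_succ, Real.mul_rpow (by positivity) hβ0.le]; ring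
        _ ≤ β ^ p * Ψ (β ^ n * x₀) := by gcongr
        _ ≤ Ψ (β * (β ^ n * x₀)) := hgrow _ h1
        _ = Ψ (β ^ (n + 1) * x₀) := by congr 1; ring
  obtain ⟨n, hn, hn'⟩ := exists_nat_pow_near ((one_le_div hx₀).2 hx) hβ
  rw [le_div_iff₀ hx₀] at hn
  rw [div_lt_iff₀ hx₀] at hn'
  have hx0 : 0 ≤ x := hx₀.le.trans hx
  rw [div_mul_eq_mul_div, le_div_iff₀ hpos]
  calc x ^ p * Ψ x₀ ≤ (β ^ (n + 1) * x₀) ^ p * Ψ x₀ := by gcongr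
    _ = (β * x₀) ^ p * ((β ^ n) ^ p * Ψ x₀) := by
        rw [← mul_assoc, ← Real.mul_rpow (by positivity) (by positivity)]; ring_nf
    _ ≤ (β * x₀) ^ p * Ψ x := by
        gcongr
        exact (hiter n).trans (hmono (by simp; positivity) hx0 hn)

/-- Under the `Δ⁰` condition an Orlicz function dominates every power, up to constants. -/
theorem IsOrliczFunction.exists_rpow_le {Ψ : ℝ → ℝ} (hΨ : IsOrliczFunction Ψ) (hΔ : Delta0 Ψ)
    {p : ℝ} (hp : 0 ≤ p) :
    ∃ A > 0, ∃ B > 0, ∀ x, 0 ≤ x → x ^ p ≤ A + B * Ψ x := by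
  obtain ⟨β, hβ, hlim⟩ := hΔ
  have hposev : ∀ᶠ x in atTop, 0 < Ψ x := by
    filter_upwards [hΨ.tendsto_div_atTop.eventually_gt_atTop 0, eventually_gt_atTop 0]
      with x h1 h2
    exact (div_pos_iff_of_pos_right h2).1 h1
  obtain ⟨N, hN⟩ := eventually_atTop.1 (hposev.and (hlim.eventually_ge_atTop (β ^ p)))
  have hx₀ : 0 < max N 1 := lt_max_of_lt_right one_pos
  have hpos : 0 < Ψ (max N 1) := (hN _ (le_max_left _ _)).1
  have hβ0 : 0 < β := one_pos.trans hβ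
  refine ⟨(max N 1) ^ p, by positivity, (β * max N 1) ^ p / Ψ (max N 1), by positivity,
    fun x hx => ?_⟩
  rcases le_total x (max N 1) with h | h
  · have h1 : x ^ p ≤ (max N 1) ^ p := by gcongr
    have h2 : 0 ≤ (β * max N 1) ^ p / Ψ (max N 1) * Ψ x :=
      mul_nonneg (by positivity) (hΨ.nonneg x)
    linarith
  · have h1 := rpow_le_mul_of_dilation_growth hΨ.mono hβ hp hx₀ hpos (fun y hy => by
      obtain ⟨h3, h4⟩ := hN y ((le_max_left _ _).trans hy)
      exact (le_div_iff₀ h3).1 h4) h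
    have h2 : 0 ≤ (max N 1) ^ p := by positivity
    linarith

theorem IsOrliczFunction.map_div_le {Ψ : ℝ → ℝ} (hΨ : IsOrliczFunction Ψ) {t x : ℝ}
    (ht : 1 ≤ t) (hx : 0 ≤ x) : Ψ (x / t) ≤ t⁻¹ * Ψ x := by
  have h := hΨ.strictConvexOn.convexOn.2 (Set.mem_Ici.2 hx) (Set.mem_Ici.2 le_rfl)
    (inv_nonneg.2 (zero_le_one.trans ht)) (sub_nonneg.2 (inv_le_one_of_one_le₀ ht))
    (by ring : t⁻¹ + (1 - t⁻¹) = 1)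
  simpa [hΨ.map_zero, div_eq_inv_mul] using h

theorem MemOrlicz.exists_modular_le_one {Ω : Type*} [MeasurableSpace Ω] {μ : Measure Ω}
    {Ψ : ℝ → ℝ} (hΨ : IsOrliczFunction Ψ) {f : Ω → ℂ} (hf : MemOrlicz Ψ μ f) :
    ∃ C : ℝ, 0 < C ∧ orliczModular Ψ μ f C ≤ 1 := by
  obtain ⟨-, C, hC, hfin⟩ := hf
  set t : ℝ := max 1 (orliczModular Ψ μ f C).toReal
  have ht : 1 ≤ t := le_max_left _ _
  have ht0 : 0 < t := one_pos.trans_le ht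
  refine ⟨C * t, by positivity, ?_⟩
  calc orliczModular Ψ μ f (C * t)
      ≤ ∫⁻ ω, ENNReal.ofReal t⁻¹ * ENNReal.ofReal (Ψ (‖f ω‖ / C)) ∂μ := by
        refine lintegral_mono fun ω => ?_
        rw [← ENNReal.ofReal_mul (by positivity), ← div_div]
        exact ENNReal.ofReal_le_ofReal (hΨ.map_div_le ht (by positivity))
    _ = ENNReal.ofReal t⁻¹ * orliczModular Ψ μ f C :=
        lintegral_const_mul' _ _ ENNReal.ofReal_ne_top
    _ ≤ ENNReal.ofReal t⁻¹ * ENNReal.ofReal t := by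
        gcongr
        exact (ENNReal.le_ofReal_iff_toReal_le hfin.ne ht0.le).2 (le_max_right _ _)
    _ = 1 := by
        rw [← ENNReal.ofReal_mul (by positivity), inv_mul_cancel₀ ht0.ne', ENNReal.ofReal_one]

/-- A pointwise bound `x ^ p ≤ A + B Ψ(x)` controls the `L^p` norm by any `C` for which the
modular is at most one. -/
theorem eLpNorm_le_of_orliczModular_le_one {Ω : Type*} [MeasurableSpace Ω] {μ : Measure Ω}
    [IsProbabilityMeasure μ] {Ψ : ℝ → ℝ} {p A B : ℝ} (hp : 0 < p) (hA : 0 ≤ A) (hB : 0 ≤ B)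
    (hΨ0 : ∀ x, 0 ≤ Ψ x) (hbound : ∀ x, 0 ≤ x → x ^ p ≤ A + B * Ψ x) {f : Ω → ℂ} {C : ℝ}
    (hC : 0 < C) (hf : orliczModular Ψ μ f C ≤ 1) :
    eLpNorm f (ENNReal.ofReal p) μ ≤ ENNReal.ofReal ((A + B) ^ (1 / p) * C) := by
  have hint : ∫⁻ ω, ‖f ω‖ₑ ^ p ∂μ ≤ ENNReal.ofReal (C ^ p * (A + B)) := by
    calc ∫⁻ ω, ‖f ω‖ₑ ^ p ∂μ
        ≤ ∫⁻ ω, ENNReal.ofReal (C ^ p) *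
            (ENNReal.ofReal A + ENNReal.ofReal B * ENNReal.ofReal (Ψ (‖f ω‖ / C))) ∂μ := by
          refine lintegral_mono fun ω => ?_
          have hΨω := hΨ0 (‖f ω‖ / C)
          rw [← ofReal_norm, ENNReal.ofReal_rpow_of_nonneg (norm_nonneg _) hp.le,
            ← ENNReal.ofReal_mul hB, ← ENNReal.ofReal_add hA (by positivity),
            ← ENNReal.ofReal_mul (by positivity)]
          refine ENNReal.ofReal_le_ofReal ?_
          have h := hbound (‖f ω‖ / C) (by positivity)
          calc ‖f ω‖ ^ p = C ^ p * (‖f ω‖ / C) ^ p := by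
                rw [← Real.mul_rpow hC.le (by positivity), mul_div_cancel₀ _ hC.ne']
            _ ≤ _ := by gcongr
      _ = ENNReal.ofReal (C ^ p) *
            (ENNReal.ofReal A + ENNReal.ofReal B * orliczModular Ψ μ f C) := by
          rw [lintegral_const_mul' _ _ ENNReal.ofReal_ne_top,
            lintegral_add_left measurable_const, lintegral_const_mul' _ _ ENNReal.ofReal_ne_top,
            lintegral_const, measure_univ, mul_one, orliczModular]
      _ ≤ ENNReal.ofReal (C ^ p) * (ENNReal.ofReal A + ENNReal.ofReal B * 1) := by gcongr
      _ = ENNReal.ofReal (C ^ p * (A + B)) := by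
          rw [mul_one, ← ENNReal.ofReal_add hA hB, ← ENNReal.ofReal_mul (by positivity)]
  rw [eLpNorm_eq_lintegral_rpow_enorm_toReal (by simpa using hp) ENNReal.ofReal_ne_top,
    ENNReal.toReal_ofReal hp.le]
  calc (∫⁻ ω, ‖f ω‖ₑ ^ p ∂μ) ^ (1 / p) ≤ ENNReal.ofReal (C ^ p * (A + B)) ^ (1 / p) := by gcongr
    _ = ENNReal.ofReal ((A + B) ^ (1 / p) * C) := by
        rw [ENNReal.ofReal_rpow_of_nonneg (by positivity) (by positivity),
          Real.mul_rpow (by positivity) (by positivity), ← Real.rpow_mul hC.le,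
          mul_one_div_cancel hp.ne', Real.rpow_one, mul_comm]

/-- If `Ψ` satisfies the `Δ⁰` condition, then for every `1 ≤ p < ∞` the Orlicz space `L^Ψ`
over a probability space embeds continuously into `L^p`. -/
theorem statement9 {Ω : Type*} [MeasurableSpace Ω] (μ : Measure Ω) [IsProbabilityMeasure μ]
    {Ψ : ℝ → ℝ} (hΨ : IsOrliczFunction Ψ) (hΔ : Delta0 Ψ) :
    ∀ p : ℝ, 1 ≤ p → ∃ C > 0, ∀ f : Ω → ℂ, MemOrlicz Ψ μ f →
      (eLpNorm f (ENNReal.ofReal p) μ).toReal ≤ C * luxNorm Ψ μ f := by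
  intro p hp
  have hp0 : 0 < p := one_pos.trans_le hp
  obtain ⟨A, hA, B, hB, hbound⟩ := hΨ.exists_rpow_le hΔ hp0.le
  have hD : 0 < (A + B) ^ (1 / p) := by positivity
  refine ⟨(A + B) ^ (1 / p), hD, fun f hf => ?_⟩
  rw [← div_le_iff₀' hD]
  refine le_csInf (hf.exists_modular_le_one hΨ) fun C hC => ?_
  rw [div_le_iff₀' hD]
  exact ENNReal.toReal_le_of_le_ofReal (mul_nonneg hD.le hC.1.le)
    (eLpNorm_le_of_orliczModular_le_one hp0 hA.le hB.le hΨ.nonneg hbound hC.1 hC.2)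

end
end

section
/- There exists an Orlicz function Ψ such that: (i) limsup_{x→∞} Ψ(2x)/Ψ(x) = +∞ (so Ψ does not satisfy the Δ₂ condition); (ii) Ψ(2x) ≥ 4 Ψ(x) for all x ≥ 0 (so the complementary function Φ of Ψ satisfies the Δ₂ condition, i.e., Ψ ∈ ∇₂); (iii) for every β > 1, liminf_{x→∞} Ψ(βx)/Ψ(x) ≤ 3β³ < +∞ (so Ψ does not satisfy the Δ⁰ condition). -/
open MeasureTheory Filter Set Topology ENNReal NNReal

noncomputable section

/-- The knots `n!²` of the example. -/
def knot (n : ℕ) : ℝ := (n.factorial : ℝ) ^ 2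

/-- The partial sums of the example: `x² + ∑_{k < n} k·k! (x - k!²)₊²`. -/
def partialPsi (n : ℕ) (x : ℝ) : ℝ :=
  x ^ 2 + ∑ k ∈ Finset.range n, (k * k.factorial : ℝ) * (max (x - knot k) 0) ^ 2

/-- The example: the (locally finite) sum `x² + ∑_k k·k! (x - k!²)₊²`. -/
def examplePsi (x : ℝ) : ℝ := partialPsi ⌈x⌉₊ x

lemma knot_pos (n : ℕ) : 0 < knot n := by
  unfold knot; positivity

lemma knot_mono : Monotone knot := by
  intro m n h
  unfold knot
  have : (m.factorial : ℝ) ≤ n.factorial := by exact_mod_cast Nat.factorial_le h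
  gcongr

lemma knot_succ (n : ℕ) : knot (n + 1) = (n + 1) ^ 2 * knot n := by
  unfold knot
  rw [Nat.factorial_succ]
  push_cast
  ring

lemma le_knot (n : ℕ) : (n : ℝ) ≤ knot n := by
  have h1 : (n : ℝ) ≤ n.factorial := by exact_mod_cast Nat.self_le_factorial n
  have h2 : (1 : ℝ) ≤ n.factorial := by exact_mod_cast Nat.factorial_pos n
  unfold knot
  nlinarith

lemma one_add_sum_mul_factorial (n : ℕ) :
    1 + ∑ k ∈ Finset.range n, (k * k.factorial : ℝ) = n.factorial := by
  induction n with
  | zero => simp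
  | succ n ih =>
    rw [Finset.sum_range_succ, ← add_assoc, ih, Nat.factorial_succ]
    push_cast
    ring

lemma partialPsi_eq {m n : ℕ} (hmn : m ≤ n) {x : ℝ} (hx : x ≤ knot m) :
    partialPsi n x = partialPsi m x := by
  unfold partialPsi
  congr 1
  symm
  apply Finset.sum_subset (Finset.range_mono hmn)
  intro k _ hk
  have hmk : m ≤ k := by simpa using hk
  rw [max_eq_right (by linarith [knot_mono hmk])]
  simp

lemma examplePsi_eq {n : ℕ} {x : ℝ} (hx : x ≤ knot n) : examplePsi x = partialPsi n x := by
  have hc : x ≤ knot ⌈x⌉₊ := (Nat.le_ceil x).trans (le_knot _)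
  rcases le_total n ⌈x⌉₊ with h | h
  · exact partialPsi_eq h hx
  · exact (partialPsi_eq h hc).symm

lemma sq_le_partialPsi (n : ℕ) (x : ℝ) : x ^ 2 ≤ partialPsi n x := by
  unfold partialPsi
  have : 0 ≤ ∑ k ∈ Finset.range n, (k * k.factorial : ℝ) * (max (x - knot k) 0) ^ 2 :=
    Finset.sum_nonneg fun k _ => by positivity
  linarith

lemma sq_le_examplePsi (x : ℝ) : x ^ 2 ≤ examplePsi x := sq_le_partialPsi _ x

lemma partialPsi_le (n : ℕ) {x : ℝ} (hx : 0 ≤ x) : partialPsi n x ≤ n.factorial * x ^ 2 := by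
  rw [← one_add_sum_mul_factorial, add_mul, one_mul, Finset.sum_mul]
  unfold partialPsi
  gcongr with k _
  exact max_le (by linarith [knot_pos k]) hx

lemma le_partialPsi_succ (n : ℕ) {x : ℝ} (hx : knot n ≤ x) :
    (n + 1).factorial * (x - knot n) ^ 2 ≤ partialPsi (n + 1) x := by
  rw [← one_add_sum_mul_factorial, add_mul, one_mul, Finset.sum_mul]
  unfold partialPsi
  have h0 : 0 ≤ x - knot n := by linarith
  gcongr with k hk
  · linarith [knot_pos n]
  · have : knot k ≤ knot n := knot_mono (by simpa [Nat.lt_succ_iff] using hk)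
    exact le_max_of_le_left (by linarith)

lemma partialPsi_monotoneOn (n : ℕ) : MonotoneOn (partialPsi n) (Set.Ici 0) := by
  intro x hx y _ hxy
  have hx : 0 ≤ x := hx
  unfold partialPsi
  gcongr

lemma partialPsi_strictConvexOn (n : ℕ) : StrictConvexOn ℝ (Set.Ici 0) (partialPsi n) := by
  unfold partialPsi
  refine StrictConvexOn.add_convexOn (strictConvexOn_pow (le_refl 2)) ?_
  induction n with
  | zero => simpa using convexOn_const (0 : ℝ) (convex_Ici (0 : ℝ))
  | succ k ih =>
  simp only [Finset.sum_range_succ]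
  refine ih.add ?_
  refine ConvexOn.smul (c := (k * k.factorial : ℝ)) (by positivity) ?_
  refine ConvexOn.pow ?_ (fun x _ => le_max_right _ _) 2
  refine ConvexOn.sup ?_ (convexOn_const 0 (convex_Ici 0))
  exact (convexOn_id (convex_Ici 0)).sub (concaveOn_const _ (convex_Ici 0))

lemma four_mul_partialPsi_le (n : ℕ) (x : ℝ) : 4 * partialPsi n x ≤ partialPsi n (2 * x) := by
  have key : ∀ k, 4 * (max (x - knot k) 0) ^ 2 ≤ (max (2 * x - knot k) 0) ^ 2 := fun k => by
    have : 2 * max (x - knot k) 0 ≤ max (2 * x - knot k) 0 := by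
      rcases max_cases (x - knot k) 0 with h | h
      · rw [h.1]; exact le_max_of_le_left (by linarith [knot_pos k])
      · rw [h.1]; simp
    calc 4 * (max (x - knot k) 0) ^ 2 = (2 * max (x - knot k) 0) ^ 2 := by ring
      _ ≤ _ := by gcongr
  unfold partialPsi
  rw [mul_add, Finset.mul_sum]
  refine add_le_add (le_of_eq (by ring)) (Finset.sum_le_sum fun k _ => ?_)
  rw [mul_left_comm]
  exact mul_le_mul_of_nonneg_left (key k) (by positivity)

lemma four_mul_examplePsi_le {x : ℝ} (hx : 0 ≤ x) : 4 * examplePsi x ≤ examplePsi (2 * x) := by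
  have h : 2 * x ≤ knot ⌈2 * x⌉₊ := (Nat.le_ceil _).trans (le_knot _)
  rw [examplePsi_eq h, examplePsi_eq (le_trans (by linarith) h)]
  exact four_mul_partialPsi_le _ _

lemma isOrliczFunction_examplePsi : IsOrliczFunction examplePsi where
  map_zero := by simp [examplePsi, partialPsi]
  nonneg x := (sq_nonneg x).trans (sq_le_examplePsi x)
  mono := by
    intro x hx y hy hxy
    have h : y ≤ knot ⌈y⌉₊ := (Nat.le_ceil _).trans (le_knot _)
    rw [examplePsi_eq h, examplePsi_eq (hxy.trans h)]
    exact partialPsi_monotoneOn _ hx hy hxy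
  strictConvexOn := by
    refine ⟨convex_Ici 0, fun x hx y hy hxy a b ha hb hab => ?_⟩
    have h : max x y ≤ knot ⌈max x y⌉₊ := (Nat.le_ceil _).trans (le_knot _)
    have hm : a • x + b • y ≤ max x y :=
      (convex_Iic (max x y)) (le_max_left x y) (le_max_right x y) ha.le hb.le hab
    rw [examplePsi_eq ((le_max_left x y).trans h), examplePsi_eq ((le_max_right x y).trans h),
      examplePsi_eq (hm.trans h)]
    exact (partialPsi_strictConvexOn _).2 hx hy hxy ha hb hab
  continuousWithinAt_zero := by
    have h : examplePsi =ᶠ[𝓝 0] fun x => x ^ 2 := by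
      filter_upwards [Iio_mem_nhds (knot_pos 0)] with x hx
      rw [examplePsi_eq (le_of_lt hx)]
      simp [partialPsi]
    exact ((continuous_pow 2).continuousAt.congr h.symm).continuousWithinAt
  tendsto_div_atTop := by
    refine tendsto_atTop_mono' _ ?_ tendsto_id
    filter_upwards [eventually_gt_atTop 0] with x hx
    rw [id, le_div_iff₀ hx, ← sq]
    exact sq_le_examplePsi x

lemma tendsto_knot : Tendsto knot atTop atTop :=
  tendsto_atTop_mono le_knot tendsto_natCast_atTop_atTop

lemma le_examplePsi_ratio (n : ℕ) :
    (n : ℝ) ≤ examplePsi (2 * knot n) / examplePsi (knot n) := by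
  have hk := knot_pos n
  have hpos : 0 < examplePsi (knot n) := (pow_pos hk 2).trans_le (sq_le_examplePsi _)
  rw [le_div_iff₀ hpos]
  have h1 : examplePsi (knot n) ≤ n.factorial * knot n ^ 2 := by
    rw [examplePsi_eq le_rfl]; exact partialPsi_le n hk.le
  rcases Nat.eq_zero_or_pos n with rfl | hn
  · simpa using isOrliczFunction_examplePsi.nonneg _
  have hn' : (1 : ℝ) ≤ n := by exact_mod_cast hn
  have h2 : 2 * knot n ≤ knot (n + 1) := by
    rw [knot_succ]
    gcongr
    nlinarith
  have h3 := le_partialPsi_succ n (x := 2 * knot n) (by linarith)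
  rw [← examplePsi_eq h2, Nat.factorial_succ] at h3
  push_cast at h3
  have h4 : 0 ≤ (n.factorial : ℝ) * knot n ^ 2 := by positivity
  nlinarith

lemma examplePsi_ratio_le {n : ℕ} {β : ℝ} (hβ : 1 < β) (hn : 3 * β ≤ n) :
    examplePsi (β * (3 * knot n)) / examplePsi (3 * knot n) ≤ 3 * β ^ 3 := by
  have hk := knot_pos n
  have hpos : 0 < examplePsi (3 * knot n) :=
    (pow_pos (by positivity) 2).trans_le (sq_le_examplePsi _)
  rw [div_le_iff₀ hpos]
  have h1 : β * (3 * knot n) ≤ knot (n + 1) := by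
    rw [knot_succ, ← mul_assoc]
    gcongr
    nlinarith
  have h2 : 3 * knot n ≤ knot (n + 1) := le_trans (by nlinarith) h1
  have h3 := le_partialPsi_succ n (x := 3 * knot n) (by linarith)
  have h4 := partialPsi_le (n + 1) (x := β * (3 * knot n)) (by positivity)
  rw [← examplePsi_eq h1] at h4
  rw [← examplePsi_eq h2] at h3
  have hc : 0 ≤ ((n + 1).factorial : ℝ) * knot n ^ 2 := by positivity
  calc examplePsi (β * (3 * knot n))
      ≤ 9 * β ^ 2 * (((n + 1).factorial : ℝ) * knot n ^ 2) := h4.trans_eq (by ring)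
    _ ≤ 12 * β ^ 3 * (((n + 1).factorial : ℝ) * knot n ^ 2) := by
        gcongr ?_ * _
        nlinarith [pow_pos (zero_lt_one.trans hβ) 2]
    _ = 3 * β ^ 3 * ((n + 1).factorial * (3 * knot n - knot n) ^ 2) := by ring
    _ ≤ _ := by gcongr

/-- If `Ψ(2y) ≥ 4Ψ(y)` and `Ψ` dominates the square function, then the complementary function
of `Ψ` satisfies `Δ₂`. -/
lemma delta2_complementaryOrlicz {Ψ : ℝ → ℝ} (hsq : ∀ y, y ^ 2 ≤ Ψ y)
    (h : ∀ y ≥ (0 : ℝ), 4 * Ψ y ≤ Ψ (2 * y)) : Delta2 (complementaryOrlicz Ψ) := by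
  refine ⟨4, by norm_num, 1, one_pos, fun x _ => ?_⟩
  have hbdd : BddAbove ((fun y => x * y - Ψ y) '' Set.Ici (0 : ℝ)) := by
    refine ⟨x ^ 2, ?_⟩
    rintro _ ⟨y, _, rfl⟩
    nlinarith [hsq y, sq_nonneg (x - y), sq_nonneg x, sq_nonneg y]
  refine csSup_le (Set.nonempty_Ici.image _) ?_
  rintro _ ⟨y, hy, rfl⟩
  have hy' : 0 ≤ y / 2 := div_nonneg hy zero_le_two
  have h1 : x * (y / 2) - Ψ (y / 2) ≤ complementaryOrlicz Ψ x :=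
    le_csSup hbdd ⟨y / 2, hy', rfl⟩
  have h2 := h (y / 2) hy'
  rw [mul_div_cancel₀ y two_ne_zero] at h2
  dsimp only
  linarith

/-- There is an Orlicz function `Ψ` with `limsup Ψ(2x)/Ψ(x) = ∞` (so `Ψ ∉ Δ₂`), with
`Ψ(2x) ≥ 4Ψ(x)` for all `x ≥ 0` (so the complementary function of `Ψ` satisfies `Δ₂`), and
with `liminf Ψ(βx)/Ψ(x) ≤ 3β³ < ∞` for every `β > 1` (so `Ψ ∉ Δ⁰`). -/
theorem statement11 :
    ∃ Ψ : ℝ → ℝ, IsOrliczFunction Ψ ∧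
      Filter.limsup (fun x : ℝ => ENNReal.ofReal (Ψ (2 * x) / Ψ x)) atTop = ⊤ ∧
      (∀ x ≥ (0 : ℝ), 4 * Ψ x ≤ Ψ (2 * x)) ∧
      Delta2 (complementaryOrlicz Ψ) ∧
      (∀ β : ℝ, 1 < β →
        Filter.liminf (fun x : ℝ => ENNReal.ofReal (Ψ (β * x) / Ψ x)) atTop
          ≤ ENNReal.ofReal (3 * β ^ 3)) := by
  refine ⟨examplePsi, isOrliczFunction_examplePsi, ?_, fun x hx => four_mul_examplePsi_le hx,
    delta2_complementaryOrlicz sq_le_examplePsi fun x hx => four_mul_examplePsi_le hx,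
    fun β hβ => ?_⟩
  · refine ENNReal.eq_top_of_forall_nnreal_le fun r => ?_
    refine le_limsup_of_frequently_le' (tendsto_knot.frequently (Eventually.frequently ?_))
    filter_upwards [eventually_ge_atTop ⌈(r : ℝ)⌉₊] with n hn
    rw [← ENNReal.ofReal_coe_nnreal]
    exact ENNReal.ofReal_le_ofReal ((Nat.ceil_le.1 hn).trans (le_examplePsi_ratio n))
  · refine liminf_le_of_frequently_le' ?_
    refine (tendsto_knot.const_mul_atTop (zero_lt_three' ℝ)).frequently (Eventually.frequently ?_)
    filter_upwards [eventually_ge_atTop ⌈3 * β⌉₊] with n hn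
    exact ENNReal.ofReal_le_ofReal (examplePsi_ratio_le hβ (Nat.ceil_le.1 hn))

end
end

section
/- Let Ψ be an Orlicz function satisfying the Δ⁰ condition, (Ω,P) a probability space, Y a Banach space, and T : M^Ψ → Y a weakly compact operator. Then for every ε > 0 there exists δ_ε > 0 such that, for every measurable set A ⊆ Ω with P(A) ≤ δ_ε, one has sup_{‖f‖_Ψ ≤ 1} ‖T(f · 1_A)‖ ≤ ε. -/
open MeasureTheory Filter Set Topology ENNReal NNReal

section WeakSeries

variable {Y : Type*} [NormedAddCommGroup Y] [NormedSpace ℂ Y]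

lemma continuous_dual_apply_weakSpace_symm (χ : StrongDual ℂ Y) :
    Continuous fun z : WeakSpace ℂ Y => χ ((toWeakSpace ℂ Y).symm z) :=
  WeakBilin.eval_continuous (topDualPairing ℂ Y).flip χ

/-- If all finite sums `∑ θₖ yₖ` with `|θₖ| ≤ 1` lie in a relatively weakly compact set, then
`y` is weakly null. -/
lemma tendsto_dual_apply_zero_of_relWeaklyCompact {y : ℕ → Y} {S : Set Y}
    (hS : RelWeaklyCompact S)
    (hy : ∀ (F : Finset ℕ) (θ : ℕ → ℂ), (∀ k, ‖θ k‖ ≤ 1) → ∑ k ∈ F, θ k • y k ∈ S)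
    (χ : StrongDual ℂ Y) : Tendsto (fun k => χ (y k)) atTop (𝓝 0) := by
  obtain ⟨K, hK, hSK⟩ := hS
  obtain ⟨C, hC⟩ := (hK.image (continuous_dual_apply_weakSpace_symm χ)).isBounded.exists_norm_le
  have hsum : ∀ F : Finset ℕ, ∑ k ∈ F, ‖χ (y k)‖ ≤ C := by
    intro F
    set θ : ℕ → ℂ := fun k => (starRingEnd ℂ) (χ (y k)) / (‖χ (y k)‖ : ℂ) with hθ
    have h1 : ∀ k, ‖θ k‖ ≤ 1 := by
      intro k
      simp only [hθ, norm_div, RCLike.norm_conj, Complex.norm_real, norm_norm]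
      exact div_self_le_one _
    have h2 := hC _ ⟨_, hSK ⟨_, hy F θ h1, rfl⟩, rfl⟩
    have h3 : χ (∑ k ∈ F, θ k • y k) = ((∑ k ∈ F, ‖χ (y k)‖ : ℝ) : ℂ) := by
      rw [map_sum]
      push_cast
      refine Finset.sum_congr rfl fun k _ => ?_
      rw [map_smul, smul_eq_mul, hθ]
      by_cases h0 : χ (y k) = 0
      · simp [h0]
      · have : (‖χ (y k)‖ : ℂ) ≠ 0 := by simpa using h0
        field_simp
        rw [← Complex.conj_mul']
    simp only [LinearEquiv.symm_apply_apply] at h2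
    rw [h3, Complex.norm_real] at h2
    exact (le_abs_self _).trans h2
  have hs : Summable fun k => ‖χ (y k)‖ := summable_of_sum_le (fun _ => norm_nonneg _) hsum
  exact tendsto_zero_iff_norm_tendsto_zero.2 hs.tendsto_atTop_zero

/-- A weakly null sequence bounded away from zero in norm has a subsequence admitting almost
biorthogonal functionals. -/
lemma exists_almost_biorthogonal {y : ℕ → Y}
    (hy : ∀ χ : StrongDual ℂ Y, Tendsto (fun k => χ (y k)) atTop (𝓝 0))
    {ε : ℝ} (hε : 0 < ε) (hyε : ∀ k, ε ≤ ‖y k‖) :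
    ∃ (n : ℕ → ℕ) (ψ : ℕ → StrongDual ℂ Y), StrictMono n ∧ (∀ i, ‖ψ i‖ ≤ 2) ∧
      (∀ i, 7 / 8 * ε ≤ ‖ψ i (y (n i))‖) ∧
      ∀ i j, i ≠ j → ‖ψ i (y (n j))‖ ≤ ε / 8 * (1 / 2) ^ i * (1 / 2) ^ j := by
  choose φ hφ1 hφy using fun k => exists_dual_vector'' ℂ (y k)
  obtain ⟨φ₀, hφ₀, hcl⟩ := (WeakDual.isCompact_closedBall (𝕜 := ℂ) (0 : StrongDual ℂ Y)
    1).exists_mapClusterPt (f := atTop) (u := fun k => StrongDual.toWeakDual (φ k))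
    (by
      refine tendsto_principal.2 (Eventually.of_forall fun k => ?_)
      simpa using hφ1 k)
  set φ' : StrongDual ℂ Y := WeakDual.toStrongDual φ₀ with hφ'
  have hφ'1 : ‖φ'‖ ≤ 1 := by simpa using hφ₀
  have hfreq : ∀ (G : Finset ℕ) (δ : ℝ), 0 < δ →
      ∃ᶠ k in atTop, ∀ m ∈ G, ‖(φ k - φ') (y m)‖ < δ := by
    intro G δ hδ
    refine (hcl.frequently (p := fun χ => ∀ m ∈ G, ‖χ (y m) - φ₀ (y m)‖ < δ) ?_)
    rw [eventually_all_finset]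
    intro m _
    have : Continuous fun χ : WeakDual ℂ Y => ‖χ (y m) - φ₀ (y m)‖ :=
      ((WeakDual.eval_continuous (y m)).sub continuous_const).norm
    refine this.continuousAt.eventually_lt continuousAt_const ?_
    simpa using hδ
  have hev : ∀ χ : StrongDual ℂ Y, ∀ δ : ℝ, 0 < δ → ∀ᶠ k in atTop, ‖χ (y k)‖ < δ := by
    intro χ δ hδ
    have := (tendsto_zero_iff_norm_tendsto_zero.1 (hy χ))
    exact this.eventually_lt_const hδ
  obtain ⟨f, hfP, hfr⟩ := exists_seq_of_forall_finset_exists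
    (fun p : ℕ × ℕ => ‖φ' (y p.2)‖ < ε / 8)
    (fun p q => p.1 < q.1 ∧ p.2 < q.2 ∧ ‖(φ q.2 - φ') (y p.2)‖ < ε / 8 * (1 / 4) ^ q.1 ∧
      ‖(φ p.2 - φ') (y q.2)‖ < ε / 8 * (1 / 4) ^ q.1) (by
      intro s _
      set N := s.sup Prod.fst + 1
      have hδ : 0 < ε / 8 * (1 / 4 : ℝ) ^ N := by positivity
      have h3 : ∀ᶠ k in atTop, ∀ p ∈ s, p.2 < k ∧
          ‖(φ p.2 - φ') (y k)‖ < ε / 8 * (1 / 4 : ℝ) ^ N := by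
        rw [eventually_all_finset]
        intro p _
        exact (eventually_gt_atTop p.2).and (hev _ _ hδ)
      obtain ⟨k, hk1, hk2, hk3⟩ := ((hfreq (s.image Prod.snd) _ hδ).and_eventually
        ((hev φ' (ε / 8) (by positivity)).and h3)).exists
      refine ⟨(N, k), hk2, fun p hp => ⟨?_, (hk3 p hp).1, ?_, (hk3 p hp).2⟩⟩
      · exact Nat.lt_succ_of_le (Finset.le_sup (f := Prod.fst) hp)
      · exact hk1 _ (Finset.mem_image_of_mem _ hp))
  have hmono : StrictMono fun i => (f i).1 := fun i j h => (hfr i j h).1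
  have hpow : ∀ i j, i < j → ε / 8 * (1 / 4 : ℝ) ^ (f j).1 ≤ ε / 8 * (1 / 2) ^ i * (1 / 2) ^ j := by
    intro i j hij
    rw [mul_assoc, ← pow_add]
    refine mul_le_mul_of_nonneg_left ?_ (by positivity)
    have : (1 / 4 : ℝ) = (1 / 2) ^ 2 := by norm_num
    rw [this, ← pow_mul]
    refine pow_le_pow_of_le_one (by norm_num) (by norm_num) ?_
    have := hmono.le_apply (x := j)
    omega
  refine ⟨fun i => (f i).2, fun i => φ (f i).2 - φ', fun i j h => (hfr i j h).2.1, fun i => ?_,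
    fun i => ?_, fun i j hij => ?_⟩
  · exact (norm_sub_le _ _).trans (by linarith [hφ1 (f i).2])
  · have h1 := hfP i
    have h2 := hyε (f i).2
    have h3 : ‖φ (f i).2 (y (f i).2)‖ = ‖y (f i).2‖ := by rw [hφy]; simp
    have h4 := norm_sub_norm_le (φ (f i).2 (y (f i).2)) (φ' (y (f i).2))
    rw [sub_apply]
    linarith
  · rcases lt_or_gt_of_ne hij with h | h
    · exact (hfr i j h).2.2.2.le.trans (hpow i j h)
    · refine (hfr j i h).2.2.1.le.trans ((hpow j i h).trans_eq ?_)
      ring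

/-- If all finite sums `∑ θₖ yₖ` with `|θₖ| ≤ 1` lie in a relatively weakly compact set, then
`y` takes values of arbitrarily small norm. -/
theorem exists_norm_lt_of_relWeaklyCompact_sums {y : ℕ → Y} {S : Set Y}
    (hS : RelWeaklyCompact S)
    (hy : ∀ (F : Finset ℕ) (θ : ℕ → ℂ), (∀ k, ‖θ k‖ ≤ 1) → ∑ k ∈ F, θ k • y k ∈ S)
    {ε : ℝ} (hε : 0 < ε) : ∃ k, ‖y k‖ < ε := by
  by_contra! hyε
  obtain ⟨n, ψ, hn, hψ2, hdiag, hoff⟩ := exists_almost_biorthogonal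
    (tendsto_dual_apply_zero_of_relWeaklyCompact hS hy) hε hyε
  obtain ⟨K, hK, hSK⟩ := hS
  set P : ℕ → Y := fun N => ∑ i ∈ Finset.range N, y (n i) with hP
  have hPS : ∀ N, P N ∈ S := by
    intro N
    have := hy ((Finset.range N).image n) (fun _ => 1) (by simp)
    rwa [Finset.sum_image (fun a _ b _ h => hn.injective h), Finset.sum_congr rfl
      (fun i _ => one_smul ℂ (y (n i)))] at this
  obtain ⟨z, -, hz⟩ := hK.exists_mapClusterPt (f := atTop) (u := fun N => toWeakSpace ℂ Y (P N))
    (tendsto_principal.2 (Eventually.of_forall fun N => hSK ⟨_, hPS N, rfl⟩))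
  set s : Y := (toWeakSpace ℂ Y).symm z with hs
  have hlow : ∀ i N, i < N → ε / 2 ≤ ‖ψ i (P N)‖ := by
    intro i N hiN
    have h1 : ψ i (P N) = ψ i (y (n i)) + ∑ j ∈ (Finset.range N).erase i, ψ i (y (n j)) := by
      rw [hP, map_sum]
      exact (Finset.add_sum_erase _ (fun j => ψ i (y (n j))) (Finset.mem_range.2 hiN)).symm
    have h2 : ‖∑ j ∈ (Finset.range N).erase i, ψ i (y (n j))‖ ≤ ε / 8 * 2 := by
      calc _ ≤ ∑ j ∈ (Finset.range N).erase i, ‖ψ i (y (n j))‖ := norm_sum_le _ _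
        _ ≤ ∑ j ∈ (Finset.range N).erase i, ε / 8 * (1 / 2 : ℝ) ^ j := by
          refine Finset.sum_le_sum fun j hj => ?_
          refine (hoff i j (Finset.ne_of_mem_erase hj).symm).trans ?_
          gcongr
          exact mul_le_of_le_one_right (by positivity) (pow_le_one₀ (by norm_num) (by norm_num))
        _ ≤ ∑ j ∈ Finset.range N, ε / 8 * (1 / 2 : ℝ) ^ j :=
          Finset.sum_le_sum_of_subset_of_nonneg (Finset.erase_subset _ _)
            fun _ _ _ => by positivity
        _ ≤ ε / 8 * 2 := by
          rw [← Finset.mul_sum]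
          gcongr
          exact sum_geometric_two_le N
    have h3 := norm_sub_norm_le (ψ i (y (n i)))
      (-∑ j ∈ (Finset.range N).erase i, ψ i (y (n j)))
    rw [sub_neg_eq_add, ← h1, norm_neg] at h3
    linarith [hdiag i]
  have hslow : ∀ i, ε / 2 ≤ ‖ψ i s‖ := by
    intro i
    by_contra! hlt
    have h1 : ∃ᶠ N in atTop, ‖ψ i (P N)‖ < ε / 2 :=
      hz.frequently (p := fun w => ‖ψ i ((toWeakSpace ℂ Y).symm w)‖ < ε / 2)
        ((continuous_dual_apply_weakSpace_symm (ψ i)).norm.continuousAt.eventually_lt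
          continuousAt_const hlt)
    obtain ⟨N, hN1, hN2⟩ := (h1.and_eventually (eventually_gt_atTop i)).exists
    exact absurd (hlow i N hN2) (not_le.2 hN1)
  set V : Submodule ℂ Y := Submodule.span ℂ (range fun i => y (n i)) with hV
  have hsV : s ∈ closure (V : Set Y) := by
    have h1 : z ∈ closure (toWeakSpace ℂ Y '' (V : Set Y)) := by
      refine ClusterPt.mem_closure_of_mem hz _ ?_
      refine mem_map.2 (Eventually.of_forall fun N => ⟨P N, ?_, rfl⟩)
      exact V.sum_mem fun i _ => Submodule.subset_span ⟨i, rfl⟩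
    have h2 : Convex ℝ (V : Set Y) := (V.restrictScalars ℝ).convex
    rw [← h2.toWeakSpace_closure ℂ] at h1
    obtain ⟨w, hw, rfl⟩ := h1
    simpa [hs] using hw
  have hVlim : ∀ v ∈ V, Tendsto (fun i => ψ i v) atTop (𝓝 0) := by
    intro v hv
    induction hv using Submodule.span_induction with
    | mem v hv =>
      obtain ⟨j, rfl⟩ := hv
      refine squeeze_zero_norm' (a := fun i => ε / 8 * (1 / 2) ^ i * (1 / 2) ^ j) ?_ ?_
      · filter_upwards [eventually_gt_atTop j] with i hi using hoff i j hi.ne'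
      · have := ((tendsto_pow_atTop_nhds_zero_of_lt_one (r := (1 / 2 : ℝ)) (by norm_num)
          (by norm_num)).const_mul (ε / 8)).mul_const ((1 / 2 : ℝ) ^ j)
        simpa using this
    | zero => simp
    | add v w _ _ hv hw => simpa using hv.add hw
    | smul c v _ hv => simpa using hv.const_mul c
  obtain ⟨v, hv, hsv⟩ := Metric.mem_closure_iff.1 hsV (ε / 16) (by positivity)
  obtain ⟨i, hi⟩ := ((tendsto_zero_iff_norm_tendsto_zero.1 (hVlim v hv)).eventually_lt_const
    (show 0 < ε / 8 by positivity)).exists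
  have h1 : ‖ψ i (s - v)‖ ≤ 2 * (ε / 16) := by
    refine (ψ i).le_of_opNorm_le_of_le (hψ2 i) ?_
    rw [← dist_eq_norm]
    exact hsv.le
  have h2 : ψ i s = ψ i (s - v) + ψ i v := by simp
  have h3 := hslow i
  rw [h2] at h3
  linarith [norm_add_le (ψ i (s - v)) (ψ i v)]

end WeakSeries

section Orlicz

variable {Ω : Type*} [MeasurableSpace Ω] {μ : Measure Ω} {Ψ : ℝ → ℝ}

lemma luxNorm_le_of_orliczModular_le_one {f : Ω → ℂ} {C : ℝ} (hC : 0 < C)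
    (h : orliczModular Ψ μ f C ≤ 1) : luxNorm Ψ μ f ≤ C :=
  csInf_le ⟨0, fun _ h => h.1.le⟩ ⟨hC, h⟩

namespace IsOrliczFunction

lemma apply_le (hΨ : IsOrliczFunction Ψ) {s t : ℝ} (hs : 0 ≤ s) (hst : s ≤ t) : Ψ s ≤ Ψ t :=
  hΨ.mono hs (hs.trans hst) hst

lemma apply_div_le (hΨ : IsOrliczFunction Ψ) {t D : ℝ} (ht : 0 ≤ t) (hD : 1 ≤ D) :
    Ψ (t / D) ≤ D⁻¹ * Ψ t := by
  have hD0 : 0 < D := by linarith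
  have h := hΨ.strictConvexOn.convexOn.2 (mem_Ici.2 ht) (mem_Ici.2 le_rfl)
    (inv_nonneg.2 hD0.le) (sub_nonneg.2 (inv_le_one_of_one_le₀ hD)) (by ring)
  simpa [hΨ.map_zero, div_eq_inv_mul] using h

lemma aemeasurable_comp (hΨ : IsOrliczFunction Ψ) {f : Ω → ℂ} (hf : AEStronglyMeasurable f μ)
    {C : ℝ} (hC : 0 ≤ C) : AEMeasurable (fun ω => ENNReal.ofReal (Ψ (‖f ω‖ / C))) μ := by
  have hm : Monotone fun t : ℝ => Ψ (max t 0) := fun s t hst =>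
    hΨ.apply_le (le_max_right _ _) (max_le_max_right 0 hst)
  have h := (hm.measurable.comp_aemeasurable (hf.norm.aemeasurable.div_const C)).ennreal_ofReal
  refine h.congr (Eventually.of_forall fun ω => ?_)
  simp [max_eq_left (div_nonneg (norm_nonneg (f ω)) hC)]

lemma orliczModular_le_of_norm_le (hΨ : IsOrliczFunction Ψ) {f g : Ω → ℂ}
    (hfg : ∀ ω, ‖g ω‖ ≤ ‖f ω‖) {C : ℝ} (hC : 0 ≤ C) :
    orliczModular Ψ μ g C ≤ orliczModular Ψ μ f C :=
  lintegral_mono fun ω => ENNReal.ofReal_le_ofReal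
    (hΨ.apply_le (by positivity) (div_le_div_of_nonneg_right (hfg ω) hC))

lemma orliczModular_anti (hΨ : IsOrliczFunction Ψ) (f : Ω → ℂ) {C D : ℝ} (hC : 0 < C)
    (hCD : C ≤ D) : orliczModular Ψ μ f D ≤ orliczModular Ψ μ f C :=
  lintegral_mono fun _ => ENNReal.ofReal_le_ofReal
    (hΨ.apply_le (div_nonneg (norm_nonneg _) (hC.le.trans hCD))
      (div_le_div_of_nonneg_left (norm_nonneg _) hC hCD))

lemma orliczModular_le_one_of_luxNorm_lt (hΨ : IsOrliczFunction Ψ) {f : Ω → ℂ}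
    (hf : MemMorseTransue Ψ μ f) {C : ℝ} (hC : luxNorm Ψ μ f < C) :
    orliczModular Ψ μ f C ≤ 1 := by
  have hne : {C : ℝ | 0 < C ∧ orliczModular Ψ μ f C ≤ 1}.Nonempty := by
    have hfin := hf.2 1 one_pos
    set D : ℝ := max 1 (orliczModular Ψ μ f 1).toReal with hD
    have hD1 : 1 ≤ D := le_max_left _ _
    have hD0 : 0 < D := by linarith
    refine ⟨D, hD0, ?_⟩
    calc orliczModular Ψ μ f D
        ≤ ∫⁻ ω, ENNReal.ofReal D⁻¹ * ENNReal.ofReal (Ψ (‖f ω‖ / 1)) ∂μ := by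
          refine lintegral_mono fun ω => ?_
          rw [← ENNReal.ofReal_mul (by positivity), div_one]
          exact ENNReal.ofReal_le_ofReal (hΨ.apply_div_le (norm_nonneg _) hD1)
      _ = ENNReal.ofReal D⁻¹ * orliczModular Ψ μ f 1 :=
          lintegral_const_mul' _ _ ENNReal.ofReal_ne_top
      _ ≤ ENNReal.ofReal D⁻¹ * ENNReal.ofReal D := by
          gcongr
          exact (ENNReal.le_ofReal_iff_toReal_le hfin.ne hD0.le).2 (le_max_right _ _)
      _ = 1 := by
          rw [← ENNReal.ofReal_mul (by positivity), inv_mul_cancel₀ hD0.ne', ENNReal.ofReal_one]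
  obtain ⟨D, ⟨hD0, hD1⟩, hDC⟩ := exists_lt_of_csInf_lt hne hC
  exact (hΨ.orliczModular_anti f hD0 hDC.le).trans hD1

lemma memMorseTransue_of_norm_le (hΨ : IsOrliczFunction Ψ) {f g : Ω → ℂ}
    (hf : MemMorseTransue Ψ μ f) (hg : AEStronglyMeasurable g μ)
    (hfg : ∀ ω, ‖g ω‖ ≤ ‖f ω‖) : MemMorseTransue Ψ μ g :=
  ⟨hg, fun C hC => (hΨ.orliczModular_le_of_norm_le hfg hC.le).trans_lt (hf.2 C hC)⟩

lemma memMorseTransue_of_bounded [IsFiniteMeasure μ] (hΨ : IsOrliczFunction Ψ) {g : Ω → ℂ}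
    (hg : AEStronglyMeasurable g μ) {M : ℝ} (hM : ∀ ω, ‖g ω‖ ≤ M) : MemMorseTransue Ψ μ g := by
  refine ⟨hg, fun C hC => ?_⟩
  calc orliczModular Ψ μ g C ≤ ∫⁻ _, ENNReal.ofReal (Ψ (M / C)) ∂μ :=
        lintegral_mono fun ω => ENNReal.ofReal_le_ofReal
          (hΨ.apply_le (by positivity) (div_le_div_of_nonneg_right (hM ω) hC.le))
    _ < ⊤ := by
        rw [lintegral_const]
        exact ENNReal.mul_lt_top ENNReal.ofReal_lt_top (measure_lt_top _ _)

lemma exists_orliczModular_tail_le_one (hΨ : IsOrliczFunction Ψ) {f : Ω → ℂ}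
    (hf : MemMorseTransue Ψ μ f) {η : ℝ} (hη : 0 < η) :
    ∃ M : ℝ, orliczModular Ψ μ ({ω | M < ‖f ω‖}.indicator f) η ≤ 1 := by
  have hset : ∀ M : ℝ, NullMeasurableSet {ω | M < ‖f ω‖} μ := fun M =>
    nullMeasurableSet_lt aemeasurable_const hf.1.norm.aemeasurable
  have h := tendsto_lintegral_of_dominated_convergence' (μ := μ) (f := fun _ => 0)
    (F := fun (n : ℕ) ω => ENNReal.ofReal (Ψ (‖{ω | (n : ℝ) < ‖f ω‖}.indicator f ω‖ / η)))
    (fun ω => ENNReal.ofReal (Ψ (‖f ω‖ / η)))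
    (fun n => hΨ.aemeasurable_comp (hf.1.indicator₀ (hset n)) hη.le)
    (fun n => Eventually.of_forall fun ω => ENNReal.ofReal_le_ofReal
      (hΨ.apply_le (by positivity)
        (div_le_div_of_nonneg_right (norm_indicator_le_norm_self _ _) hη.le)))
    (hf.2 η hη).ne
    (Eventually.of_forall fun ω => by
      refine tendsto_const_nhds.congr' ?_
      filter_upwards [eventually_ge_atTop ⌈‖f ω‖⌉₊] with n hn
      have : ω ∉ {ω | (n : ℝ) < ‖f ω‖} := not_lt.2 (Nat.ceil_le.1 hn)
      simp [indicator_of_notMem this, hΨ.map_zero])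
  rw [lintegral_zero] at h
  obtain ⟨n, hn⟩ := (h.eventually_lt_const one_pos).exists
  exact ⟨n, hn.le⟩

/-- Up to a small error, `T (f 1_A)` is unchanged when the small and the large values of `f` are
cut off. -/
lemma exists_truncation (hΨ : IsOrliczFunction Ψ) {Y : Type*} [NormedAddCommGroup Y]
    [NormedSpace ℂ Y] {T : (Ω → ℂ) →ₗ[ℂ] Y} {B : ℝ} (hB : 0 ≤ B)
    (hT : ∀ f : Ω → ℂ, MemMorseTransue Ψ μ f → ‖T f‖ ≤ B * luxNorm Ψ μ f)
    {f : Ω → ℂ} (hf : MemMorseTransue Ψ μ f) {A : Set Ω} (hA : MeasurableSet A)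
    {x η : ℝ} (hη : 0 < η)
    (hAx : μ A * ENNReal.ofReal (Ψ (x / η)) ≤ 1) :
    ∃ (M : ℝ) (h : Ω → ℂ), x ≤ M ∧ AEStronglyMeasurable h μ ∧
      (∀ ω, h ω ≠ 0 → x < ‖h ω‖) ∧ (∀ ω, h ω ≠ 0 → ‖h ω‖ ≤ M) ∧ (∀ ω, ‖h ω‖ ≤ ‖f ω‖) ∧
      ‖T (A.indicator f)‖ ≤ ‖T h‖ + 2 * B * η := by
  obtain ⟨M₀, hM₀⟩ := hΨ.exists_orliczModular_tail_le_one hf hη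
  set M := max M₀ x with hM
  have hmeas := hf.1.norm.aemeasurable
  have hlow : NullMeasurableSet {ω | ‖f ω‖ ≤ x} μ := nullMeasurableSet_le hmeas aemeasurable_const
  have hhigh : NullMeasurableSet {ω | M < ‖f ω‖} μ := nullMeasurableSet_lt aemeasurable_const hmeas
  set g₁ := (A ∩ {ω | ‖f ω‖ ≤ x}).indicator f with hg₁
  set g₂ := (A ∩ {ω | M < ‖f ω‖}).indicator f with hg₂
  set h := (A ∩ ({ω | ‖f ω‖ ≤ x}ᶜ ∩ {ω | M < ‖f ω‖}ᶜ)).indicator f with hh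
  have hsm := hf.1.indicator₀ (hA.nullMeasurableSet.inter (hlow.compl.inter hhigh.compl))
  have hmem : ∀ ω, h ω ≠ 0 → h ω = f ω ∧ x < ‖f ω‖ ∧ ‖f ω‖ ≤ M := by
    intro ω hω
    have := mem_of_indicator_ne_zero hω
    exact ⟨indicator_of_mem this f, not_le.1 this.2.1, not_lt.1 this.2.2⟩
  have hbound : ∀ g : Ω → ℂ, MemMorseTransue Ψ μ g → orliczModular Ψ μ g η ≤ 1 →
      ‖T g‖ ≤ B * η := fun g hg h1 => (hT g hg).trans
    (mul_le_mul_of_nonneg_left (luxNorm_le_of_orliczModular_le_one hη h1) hB)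
  have hT₁ : ‖T g₁‖ ≤ B * η := by
    refine hbound _ (hΨ.memMorseTransue_of_norm_le hf
      (hf.1.indicator₀ (hA.nullMeasurableSet.inter hlow))
      fun ω => norm_indicator_le_norm_self _ _) ?_
    refine le_trans ?_ ((mul_comm _ _).trans_le hAx)
    refine le_trans (lintegral_mono fun ω => ?_) (lintegral_indicator_const_le A _)
    by_cases hω : ω ∈ A ∩ {ω | ‖f ω‖ ≤ x}
    · rw [hg₁, indicator_of_mem hω, indicator_of_mem hω.1]
      exact ENNReal.ofReal_le_ofReal
        (hΨ.apply_le (by positivity) (div_le_div_of_nonneg_right hω.2 hη.le))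
    · simp [hg₁, indicator_of_notMem hω, hΨ.map_zero]
  have hT₂ : ‖T g₂‖ ≤ B * η := by
    refine hbound _ (hΨ.memMorseTransue_of_norm_le hf
      (hf.1.indicator₀ (hA.nullMeasurableSet.inter hhigh))
      fun ω => norm_indicator_le_norm_self _ _) ?_
    refine (hΨ.orliczModular_le_of_norm_le (fun ω => ?_) hη.le).trans hM₀
    have hsub : A ∩ {ω | M < ‖f ω‖} ⊆ {ω | M₀ < ‖f ω‖} :=
      fun ω hω => (le_max_left M₀ x).trans_lt hω.2
    exact norm_indicator_le_of_subset hsub f ω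
  have hsplit : A.indicator f = g₁ + h + g₂ := by
    have hxM : x ≤ M := le_max_right _ _
    funext ω
    simp only [hg₁, hg₂, hh, Pi.add_apply]
    by_cases hA' : ω ∈ A <;> by_cases h1 : ‖f ω‖ ≤ x <;> by_cases h2 : M < ‖f ω‖ <;>
      simp [hA', h1, h2]
    linarith
  refine ⟨M, h, le_max_right _ _, hsm, fun ω hω => ?_, fun ω hω => ?_,
    fun ω => norm_indicator_le_norm_self _ _, ?_⟩
  · rw [(hmem ω hω).1]
    exact (hmem ω hω).2.1
  · rw [(hmem ω hω).1]
    exact (hmem ω hω).2.2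
  · rw [hsplit, map_add, map_add]
    linarith [norm_add₃_le (a := T g₁) (b := T h) (c := T g₂)]

/-- Functions whose nonzero values lie in rapidly increasing bands satisfy an upper `c₀` estimate:
their sums with coefficients in the unit disc stay bounded. -/
lemma orliczModular_sum_le_one (hΨ : IsOrliczFunction Ψ) {β : ℝ} (hβ : 0 < β) {x M : ℕ → ℝ}
    (hM : ∀ k, 0 ≤ M k) (hx : ∀ k, ∑ j ∈ Finset.range k, M j ≤ x k)
    (hxΨ : ∀ k t, x k / (2 * β) ≤ t → 2 ^ (k + 1) * Ψ t ≤ Ψ (β * t))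
    {h : ℕ → Ω → ℂ} (hm : ∀ k, AEStronglyMeasurable (h k) μ)
    (hlow : ∀ k ω, h k ω ≠ 0 → x k < ‖h k ω‖) (hup : ∀ k ω, h k ω ≠ 0 → ‖h k ω‖ ≤ M k)
    (h1 : ∀ k, orliczModular Ψ μ (h k) 2 ≤ 1)
    (F : Finset ℕ) {θ : ℕ → ℂ} (hθ : ∀ k, ‖θ k‖ ≤ 1) :
    orliczModular Ψ μ (∑ k ∈ F, θ k • h k) (4 * β) ≤ 1 := by
  have hpt : ∀ ω, ENNReal.ofReal (Ψ (‖(∑ k ∈ F, θ k • h k) ω‖ / (4 * β))) ≤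
      ∑ k ∈ F, ENNReal.ofReal ((1 / 2) ^ (k + 1)) * ENNReal.ofReal (Ψ (‖h k ω‖ / 2)) := by
    intro ω
    set G := F.filter fun k => h k ω ≠ 0 with hG
    have hsum : ‖(∑ k ∈ F, θ k • h k) ω‖ ≤ ∑ k ∈ G, ‖h k ω‖ := by
      rw [Finset.sum_apply, hG, Finset.sum_filter_of_ne (fun k _ hk => by simpa using hk)]
      refine (norm_sum_le _ _).trans (Finset.sum_le_sum fun k _ => ?_)
      rw [Pi.smul_apply, norm_smul]
      exact mul_le_of_le_one_left (norm_nonneg _) (hθ k)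
    rcases G.eq_empty_or_nonempty with hGe | hGn
    · rw [hGe, Finset.sum_empty] at hsum
      rw [le_antisymm hsum (norm_nonneg _), zero_div, hΨ.map_zero, ENNReal.ofReal_zero]
      exact zero_le
    · set K := G.max' hGn with hK
      have hKG : K ∈ G := G.max'_mem hGn
      obtain ⟨hKF, hKω⟩ := Finset.mem_filter.1 hKG
      have hprev : ∑ k ∈ G.erase K, ‖h k ω‖ ≤ x K := by
        calc ∑ k ∈ G.erase K, ‖h k ω‖ ≤ ∑ k ∈ G.erase K, M k :=
              Finset.sum_le_sum fun k hk =>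
                hup k ω (Finset.mem_filter.1 (Finset.mem_of_mem_erase hk)).2
          _ ≤ ∑ k ∈ Finset.range K, M k :=
              Finset.sum_le_sum_of_subset_of_nonneg
                (fun k hk => Finset.mem_range.2 (lt_of_le_of_ne
                  (G.le_max' k (Finset.mem_of_mem_erase hk)) (Finset.ne_of_mem_erase hk)))
                fun k _ _ => hM k
          _ ≤ x K := hx K
      have htot : ‖(∑ k ∈ F, θ k • h k) ω‖ ≤ 2 * ‖h K ω‖ := by
        rw [← Finset.add_sum_erase _ _ hKG] at hsum
        linarith [hlow K ω hKω]
      refine le_trans ?_ (Finset.single_le_sum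
        (f := fun k => ENNReal.ofReal ((1 / 2) ^ (k + 1)) * ENNReal.ofReal (Ψ (‖h k ω‖ / 2)))
        (fun _ _ => zero_le) hKF)
      rw [← ENNReal.ofReal_mul (by positivity)]
      refine ENNReal.ofReal_le_ofReal ?_
      have h2 := hxΨ K (‖h K ω‖ / (2 * β))
        (div_le_div_of_nonneg_right (hlow K ω hKω).le (by positivity))
      have h3 : β * (‖h K ω‖ / (2 * β)) = ‖h K ω‖ / 2 := by field_simp
      rw [h3] at h2
      calc Ψ (‖(∑ k ∈ F, θ k • h k) ω‖ / (4 * β)) ≤ Ψ (‖h K ω‖ / (2 * β)) := by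
            refine hΨ.apply_le (by positivity) ?_
            rw [div_le_div_iff₀ (by positivity) (by positivity)]
            nlinarith
        _ = (1 / 2) ^ (K + 1) * (2 ^ (K + 1) * Ψ (‖h K ω‖ / (2 * β))) := by
            rw [← mul_assoc, ← mul_pow]
            norm_num
        _ ≤ (1 / 2) ^ (K + 1) * Ψ (‖h K ω‖ / 2) := by gcongr
  calc orliczModular Ψ μ (∑ k ∈ F, θ k • h k) (4 * β)
      ≤ ∫⁻ ω, ∑ k ∈ F, ENNReal.ofReal ((1 / 2) ^ (k + 1)) *
          ENNReal.ofReal (Ψ (‖h k ω‖ / 2)) ∂μ := lintegral_mono hpt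
    _ = ∑ k ∈ F, ENNReal.ofReal ((1 / 2) ^ (k + 1)) * orliczModular Ψ μ (h k) 2 := by
        rw [lintegral_finsetSum' _ fun k _ =>
          (hΨ.aemeasurable_comp (hm k) zero_le_two).const_mul _]
        exact Finset.sum_congr rfl fun k _ => lintegral_const_mul' _ _ ENNReal.ofReal_ne_top
    _ ≤ ∑ k ∈ F, ENNReal.ofReal ((1 / 2) ^ (k + 1)) :=
        Finset.sum_le_sum fun k _ => mul_le_of_le_one_right zero_le (h1 k)
    _ = ENNReal.ofReal (∑ k ∈ F, (1 / 2) ^ (k + 1)) :=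
        (ENNReal.ofReal_sum_of_nonneg fun _ _ => by positivity).symm
    _ ≤ 1 := by
        refine ENNReal.ofReal_le_one.2 ?_
        have hs : Summable fun k : ℕ => (1 / 2 : ℝ) ^ k := summable_geometric_two
        have h2 := hs.sum_le_tsum F fun _ _ => by positivity
        rw [tsum_geometric_two] at h2
        simp_rw [pow_succ, ← Finset.sum_mul]
        linarith

end IsOrliczFunction

lemma Delta0.exists_threshold (hΨ : IsOrliczFunction Ψ) {β : ℝ}
    (hβ : Tendsto (fun x => Ψ (β * x) / Ψ x) atTop atTop) (C : ℝ) :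
    ∃ c : ℝ, 0 ≤ c ∧ ∀ t, c ≤ t → C * Ψ t ≤ Ψ (β * t) := by
  obtain ⟨c, hc⟩ := eventually_atTop.1 (hβ.eventually_ge_atTop C)
  refine ⟨max c 0, le_max_right _ _, fun t ht => ?_⟩
  rcases (hΨ.nonneg t).eq_or_lt with h0 | h0
  · rw [← h0, mul_zero]
    exact hΨ.nonneg _
  · exact (le_div_iff₀ h0).1 (hc t ((le_max_left _ _).trans ht))

end Orlicz

noncomputable section

/-- If `Ψ ∈ Δ⁰` and `T : M^Ψ → Y` is weakly compact, then for every `ε > 0` there is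
`δ_ε > 0` such that `P(A) ≤ δ_ε` implies `sup_{‖f‖_Ψ ≤ 1} ‖T(f·1_A)‖ ≤ ε`. -/
theorem statement15 {Ω : Type*} [MeasurableSpace Ω] (μ : Measure Ω) [IsProbabilityMeasure μ]
    {Ψ : ℝ → ℝ} (hΨ : IsOrliczFunction Ψ) (hΔ : Delta0 Ψ)
    {Y : Type*} [NormedAddCommGroup Y] [NormedSpace ℂ Y] [CompleteSpace Y]
    (T : (Ω → ℂ) →ₗ[ℂ] Y)
    (hTbdd : ∃ M : ℝ, ∀ f : Ω → ℂ, MemMorseTransue Ψ μ f → ‖T f‖ ≤ M * luxNorm Ψ μ f)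
    (hTwc : RelWeaklyCompact
      (⇑T '' {f : Ω → ℂ | MemMorseTransue Ψ μ f ∧ luxNorm Ψ μ f ≤ 1})) :
    ∀ ε > 0, ∃ δ > 0, ∀ A : Set Ω, MeasurableSet A → μ A ≤ ENNReal.ofReal δ →
      ∀ f : Ω → ℂ, MemMorseTransue Ψ μ f → luxNorm Ψ μ f ≤ 1 →
        ‖T (A.indicator f)‖ ≤ ε := by
  obtain ⟨β, hβ1, hβ⟩ := hΔ
  obtain ⟨B₀, hB₀⟩ := hTbdd
  have hβ0 : 0 < β := by linarith
  set B : ℝ := |B₀| + 1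
  have hB : 0 < B := by positivity
  have hTB : ∀ f : Ω → ℂ, MemMorseTransue Ψ μ f → ‖T f‖ ≤ B * luxNorm Ψ μ f := fun f hf =>
    (hB₀ f hf).trans (mul_le_mul_of_nonneg_right (by linarith [le_abs_self B₀])
      (Real.sInf_nonneg fun C hC => hC.1.le))
  intro ε hε
  by_contra! hcon
  have hblock : ∀ x : ℝ, ∃ (M : ℝ) (h : Ω → ℂ), x ≤ M ∧ AEStronglyMeasurable h μ ∧
      (∀ ω, h ω ≠ 0 → x < ‖h ω‖) ∧ (∀ ω, h ω ≠ 0 → ‖h ω‖ ≤ M) ∧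
      orliczModular Ψ μ h 2 ≤ 1 ∧ ε / 2 ≤ ‖T h‖ := by
    intro x
    set η : ℝ := ε / (4 * B)
    have hη : 0 < η := by positivity
    have hΨx : 0 < Ψ (x / η) + 1 := by linarith [hΨ.nonneg (x / η)]
    obtain ⟨A, hA, hAδ, f, hf, hf1, hfε⟩ := hcon (Ψ (x / η) + 1)⁻¹ (inv_pos.2 hΨx)
    obtain ⟨M, h, hxM, hm, hlow, hup, hle, hTh⟩ := hΨ.exists_truncation hB.le hTB hf hA
      (x := x) hη (by
        refine (mul_le_mul_left hAδ _).trans ?_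
        rw [← ENNReal.ofReal_mul (inv_nonneg.2 hΨx.le), ENNReal.ofReal_le_one, inv_mul_le_one₀ hΨx]
        linarith)
    refine ⟨M, h, hxM, hm, hlow, hup, ?_, ?_⟩
    · exact (hΨ.orliczModular_le_of_norm_le hle zero_le_two).trans
        (hΨ.orliczModular_le_one_of_luxNorm_lt hf (by linarith))
    · have : 2 * B * η = ε / 2 := by
        simp only [η]
        field_simp
        norm_num
      linarith
  choose M h hxM hm hlow hup h1 hTh using hblock
  choose c hc0 hc using fun k : ℕ => Delta0.exists_threshold hΨ hβ (2 ^ (k + 1))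
  set x : ℕ → ℝ := fun k => Nat.rec (2 * β * c 0)
    (fun k xk => max (2 * M xk) (2 * β * c (k + 1))) k with hx
  have hxc : ∀ k, 2 * β * c k ≤ x k := by
    rintro (_ | k)
    · exact le_rfl
    · exact le_max_right _ _
  have hx0 : ∀ k, 0 ≤ x k := fun k => le_trans (mul_nonneg (by positivity) (hc0 k)) (hxc k)
  have hxsum : ∀ k, ∑ j ∈ Finset.range k, M (x j) ≤ x k := by
    intro k
    induction k with
    | zero => simpa using hx0 0
    | succ k ih =>
      have h2 : 2 * M (x k) ≤ x (k + 1) := le_max_left _ _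
      rw [Finset.sum_range_succ]
      linarith [hxM (x k)]
  have hsum : ∀ (F : Finset ℕ) (θ : ℕ → ℂ), (∀ k, ‖θ k‖ ≤ 1) →
      orliczModular Ψ μ (∑ k ∈ F, θ k • h (x k)) (4 * β) ≤ 1 := fun F θ hθ =>
    hΨ.orliczModular_sum_le_one hβ0 (M := fun k => M (x k))
      (fun k => (hx0 k).trans (hxM (x k))) hxsum
      (fun k t ht => hc k t (by
        refine le_trans ?_ ht
        rw [le_div_iff₀ (by positivity), mul_comm]
        exact hxc k))
      (fun k => hm _) (fun k => hlow _) (fun k => hup _) (fun k => h1 _) F hθ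
  set r : ℂ := ((4 * β : ℝ) : ℂ)⁻¹ with hr
  have hrn : ‖r‖ = (4 * β)⁻¹ := by
    rw [hr, norm_inv, Complex.norm_real, Real.norm_of_nonneg (by positivity)]
  obtain ⟨k, hk⟩ := exists_norm_lt_of_relWeaklyCompact_sums hTwc
    (y := fun k => r • T (h (x k))) (fun F θ hθ => by
      refine ⟨r • ∑ k ∈ F, θ k • h (x k), ⟨?_, ?_⟩, ?_⟩
      · refine hΨ.memMorseTransue_of_bounded (M := ‖r‖ * ∑ k ∈ F, M (x k)) ?_ fun ω => ?_
        · exact (Finset.aestronglyMeasurable_sum F fun k _ => (hm (x k)).const_smul _).const_smul _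
        · rw [Pi.smul_apply, norm_smul, Finset.sum_apply]
          refine mul_le_mul_of_nonneg_left
            (norm_sum_le_of_le F fun k _ => ?_) (norm_nonneg _)
          rw [Pi.smul_apply, norm_smul]
          refine (mul_le_of_le_one_left (norm_nonneg _) (hθ k)).trans ?_
          by_cases h0 : h (x k) ω = 0
          · rw [h0, norm_zero]
            exact (hx0 k).trans (hxM _)
          · exact hup _ _ h0
      · refine luxNorm_le_of_orliczModular_le_one one_pos ((le_of_eq ?_).trans (hsum F θ hθ))
        refine lintegral_congr fun ω => ?_
        rw [Pi.smul_apply, norm_smul, hrn, div_one, div_eq_inv_mul]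
      · simp only [map_smul, map_sum, Finset.smul_sum]
        exact Finset.sum_congr rfl fun k _ => smul_comm _ _ _)
    (ε := (4 * β)⁻¹ * (ε / 2)) (by positivity)
  rw [norm_smul, hrn] at hk
  exact absurd (lt_of_mul_lt_mul_left hk (by positivity)) (not_lt.2 (hTh (x k)))

end
end
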